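/- arXiv:1605.01021 — 6 statements merged into one kernel-verified Lean document; each statement's English description precedes it below -/
import Mathlib

section
/- Strict information monotonicity of f-divergence (Fact 2.3 strictness / Corollary 2.4): Let Σ and Σ' be finite sets, let p and q be probability mass functions on Σ with p(σ) > 0 and q(σ) > 0 for all σ ∈ Σ, let θ be a transition matrix from Σ to Σ' such that θᵀp and θᵀq are strictly positive on Σ', and let f : ℝ → ℝ be strictly convex with f(1) = 0. If there exist σ', σ'' ∈ Σ and σ ∈ Σ' such that q(σ')/p(σ') ≠ q(σ'')/p(σ''), θ(σ',σ) > 0 and θ(σ'',σ) > 0, then D_f(θᵀp, θᵀq) < D_f(p, q). -/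
/-- Jensen's inequality with unnormalized weights. -/
theorem ConvexOn.sum_mul_map_div_le {ι : Type*} [Fintype ι] {f : ℝ → ℝ}
    (hf : ConvexOn ℝ Set.univ f) {w : ι → ℝ} (hw : ∀ i, 0 ≤ w i) (hpos : 0 < ∑ i, w i)
    (x : ι → ℝ) :
    (∑ i, w i) * f ((∑ i, w i * x i) / ∑ i, w i) ≤ ∑ i, w i * f (x i) := by
  have h := hf.map_sum_le (t := Finset.univ) (w := fun i => w i / ∑ j, w j) (p := x)
    (fun i _ => div_nonneg (hw i) hpos.le)
    (by rw [← Finset.sum_div, div_self hpos.ne']) (fun _ _ => Set.mem_univ _)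
  simp only [smul_eq_mul, div_mul_eq_mul_div, ← Finset.sum_div] at h
  rwa [le_div_iff₀' hpos] at h

/-- Strict Jensen's inequality with unnormalized weights. -/
theorem StrictConvexOn.sum_mul_map_div_lt {ι : Type*} [Fintype ι] {f : ℝ → ℝ}
    (hf : StrictConvexOn ℝ Set.univ f) {w : ι → ℝ} (hw : ∀ i, 0 ≤ w i) (hpos : 0 < ∑ i, w i)
    (x : ι → ℝ) {j k : ι} (hj : 0 < w j) (hk : 0 < w k) (hjk : x j ≠ x k) :
    (∑ i, w i) * f ((∑ i, w i * x i) / ∑ i, w i) < ∑ i, w i * f (x i) := by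
  have h := (hf.map_sum_lt_iff_of_nonneg (t := Finset.univ) (w := fun i => w i / ∑ j, w j) (p := x)
    (fun i _ => div_nonneg (hw i) hpos.le)
    (by rw [← Finset.sum_div, div_self hpos.ne']) (fun _ _ => Set.mem_univ _)).2
    ⟨j, Finset.mem_univ _, k, Finset.mem_univ _, (div_pos hj hpos).ne', (div_pos hk hpos).ne', hjk⟩
  simp only [smul_eq_mul, div_mul_eq_mul_div, ← Finset.sum_div] at h
  rwa [lt_div_iff₀' hpos] at h

/-- **Strict information monotonicity of f-divergence.**
For strictly positive pmfs `p, q` on a finite set `S`, a transition matrix `θ`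
from `S` to `S'` with strictly positive pushforwards, and a strictly convex `f`
with `f 1 = 0`: if there exist `σ', σ'' ∈ S` and `σ ∈ S'` with
`q σ' / p σ' ≠ q σ'' / p σ''`, `θ σ' σ > 0` and `θ σ'' σ > 0`, then
`D_f(θᵀp, θᵀq) < D_f(p, q)`. -/
theorem f_divergence_strict_information_monotonicity
    {S S' : Type*} [Fintype S] [Fintype S']
    (p q : S → ℝ)
    (hp_pos : ∀ σ, 0 < p σ) (hq_pos : ∀ σ, 0 < q σ)
    (hp_sum : ∑ σ, p σ = 1) (hq_sum : ∑ σ, q σ = 1)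
    (θ : S → S' → ℝ)
    (hθ_nonneg : ∀ σ σ', 0 ≤ θ σ σ')
    (hθ_rows : ∀ σ, ∑ σ', θ σ σ' = 1)
    (hθp_pos : ∀ σ', 0 < ∑ σ, θ σ σ' * p σ)
    (hθq_pos : ∀ σ', 0 < ∑ σ, θ σ σ' * q σ)
    (f : ℝ → ℝ) (hf : StrictConvexOn ℝ Set.univ f) (hf1 : f 1 = 0)
    (σ' σ'' : S) (σ : S')
    (hdist : q σ' / p σ' ≠ q σ'' / p σ'')
    (hθ1 : 0 < θ σ' σ) (hθ2 : 0 < θ σ'' σ) :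
    ∑ τ', (∑ τ, θ τ τ' * p τ) * f ((∑ τ, θ τ τ' * q τ) / (∑ τ, θ τ τ' * p τ))
      < ∑ τ, p τ * f (q τ / p τ) := by
  have hq (τ' : S') : ∑ τ, θ τ τ' * q τ = ∑ τ, θ τ τ' * p τ * (q τ / p τ) :=
    Finset.sum_congr rfl fun τ _ => by rw [mul_assoc, mul_div_cancel₀ _ (hp_pos τ).ne']
  have hw (τ' : S') (τ : S) : 0 ≤ θ τ τ' * p τ := mul_nonneg (hθ_nonneg τ τ') (hp_pos τ).le
  have hD : ∑ τ, p τ * f (q τ / p τ) = ∑ τ', ∑ τ, θ τ τ' * p τ * f (q τ / p τ) := by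
    rw [Finset.sum_comm]
    refine Finset.sum_congr rfl fun τ _ => ?_
    rw [← Finset.sum_mul, ← Finset.sum_mul, hθ_rows, one_mul]
  simp only [hD, hq]
  exact Finset.sum_lt_sum
    (fun τ' _ => hf.convexOn.sum_mul_map_div_le (hw τ') (hθp_pos τ') fun τ => q τ / p τ)
    ⟨σ, Finset.mem_univ σ, hf.sum_mul_map_div_lt (hw σ) (hθp_pos σ) (fun τ => q τ / p τ)
      (mul_pos hθ1 (hp_pos σ')) (mul_pos hθ2 (hp_pos σ'')) hdist⟩
end

section
/- Mixed-effort payment bound (key inequality in the proof of Theorem 4.4): Let Σ_X, Σ_Y be finite sets, let 0 ≤ λ ≤ 1, let P₁ be a joint pmf on Σ_X × Σ_Y with Y-marginal P_Y, and let p be any pmf on Σ_X, so that the product pmf p ⊗ P_Y models a report that is independent of Y. Let f : ℝ → ℝ be convex with f(1) = 0, and assume P₁, p ⊗ P_Y, λP₁ + (1−λ)(p ⊗ P_Y) and all of their marginals are strictly positive. Then MI_f(λP₁ + (1−λ)(p ⊗ P_Y)) ≤ λ·MI_f(P₁). -/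
/-- The f-mutual information of a joint pmf `P` on `X × Y`:
`MI_f(P) = Σ_{x,y} P(x,y)·f(P_X(x)·P_Y(y)/P(x,y))`. -/
noncomputable def MIf {X Y : Type*} [Fintype X] [Fintype Y]
    (f : ℝ → ℝ) (P : X → Y → ℝ) : ℝ :=
  ∑ x, ∑ y, P x y * f ((∑ y', P x y') * (∑ x', P x' y) / P x y)

/-- The perspective form of Jensen's inequality for two points, one of which is a zero of `f`. -/
theorem ConvexOn.mul_map_add_div_le {f : ℝ → ℝ} (hf : ConvexOn ℝ Set.univ f) (hf1 : f 1 = 0)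
    {a b u : ℝ} (ha : 0 ≤ a) (hb : 0 ≤ b) (hab : 0 < a + b) :
    (a + b) * f ((a * u + b) / (a + b)) ≤ a * f u := by
  have h := hf.2 (Set.mem_univ u) (Set.mem_univ 1) (div_nonneg ha hab.le)
    (div_nonneg hb hab.le) (by field_simp)
  simp only [smul_eq_mul, hf1, mul_zero, add_zero, mul_one] at h
  calc (a + b) * f ((a * u + b) / (a + b))
      = (a + b) * f (a / (a + b) * u + b / (a + b)) := by congr 2; ring
    _ ≤ (a + b) * (a / (a + b) * f u) := mul_le_mul_of_nonneg_left h hab.le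
    _ = a * f u := by field_simp

/-- **Mixed-effort payment bound** (key inequality in the proof of Theorem 4.4).
For `0 ≤ l ≤ 1`, a joint pmf `P₁` on `Σ_X × Σ_Y` with `Y`-marginal `P_Y`,
and any pmf `p` on `Σ_X`, mixing `P₁` with the product pmf `p ⊗ P_Y`
(which models a report independent of `Y`) gives
`MI_f(l•P₁ + (1−l)•(p ⊗ P_Y)) ≤ l·MI_f(P₁)`, provided `f` is convex with
`f 1 = 0` and `P₁`, `p ⊗ P_Y`, the mixture and all their marginals are
strictly positive. -/
theorem f_mutual_information_mixed_effort_bound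
    {X Y : Type*} [Fintype X] [Fintype Y]
    (l : ℝ) (hl0 : 0 ≤ l) (hl1 : l ≤ 1)
    (P₁ : X → Y → ℝ)
    (hP₁_pos : ∀ x y, 0 < P₁ x y)
    (hP₁_sum : ∑ x, ∑ y, P₁ x y = 1)
    (hP₁X_pos : ∀ x, 0 < ∑ y, P₁ x y)
    (hP₁Y_pos : ∀ y, 0 < ∑ x, P₁ x y)
    (p : X → ℝ)
    (hp_nonneg : ∀ x, 0 ≤ p x) (hp_sum : ∑ x, p x = 1)
    (hprod_pos : ∀ x y, 0 < p x * (∑ x', P₁ x' y))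
    (hprodX_pos : ∀ x, 0 < ∑ y, p x * (∑ x', P₁ x' y))
    (hprodY_pos : ∀ y, 0 < ∑ x, p x * (∑ x', P₁ x' y))
    (hmix_pos : ∀ x y, 0 < l * P₁ x y + (1 - l) * (p x * (∑ x', P₁ x' y)))
    (hmixX_pos : ∀ x, 0 < ∑ y, (l * P₁ x y + (1 - l) * (p x * (∑ x', P₁ x' y))))
    (hmixY_pos : ∀ y, 0 < ∑ x, (l * P₁ x y + (1 - l) * (p x * (∑ x', P₁ x' y))))
    (f : ℝ → ℝ) (hf : ConvexOn ℝ Set.univ f) (hf1 : f 1 = 0) :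
    MIf f (fun x y => l * P₁ x y + (1 - l) * (p x * (∑ x', P₁ x' y)))
      ≤ l * MIf f P₁ := by
  have hPY : ∑ y, ∑ x, P₁ x y = 1 := by rw [Finset.sum_comm, hP₁_sum]
  have hmixX (x : X) : ∑ y, (l * P₁ x y + (1 - l) * (p x * ∑ x', P₁ x' y))
      = l * ∑ y, P₁ x y + (1 - l) * p x := by
    simp only [Finset.sum_add_distrib, ← Finset.mul_sum, hPY, mul_one]
  have hmixY (y : Y) : ∑ x, (l * P₁ x y + (1 - l) * (p x * ∑ x', P₁ x' y))
      = ∑ x, P₁ x y := by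
    simp only [Finset.sum_add_distrib, ← Finset.mul_sum, ← Finset.sum_mul, hp_sum]
    ring
  simp only [MIf, hmixX, hmixY]
  refine le_of_le_of_eq (Finset.sum_le_sum fun x _ => ?_) (Finset.mul_sum ..).symm
  refine le_of_le_of_eq (Finset.sum_le_sum fun y _ => ?_) (Finset.mul_sum ..).symm
  have hP := (hP₁_pos x y).ne'
  have h := hf.mul_map_add_div_le hf1 (u := (∑ y', P₁ x y') * (∑ x', P₁ x' y) / P₁ x y)
    (mul_nonneg hl0 (hP₁_pos x y).le)
    (mul_nonneg (sub_nonneg.2 hl1) (hprod_pos x y).le) (hmix_pos x y)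
  have hnum : l * P₁ x y * ((∑ y', P₁ x y') * (∑ x', P₁ x' y) / P₁ x y)
      + (1 - l) * (p x * ∑ x', P₁ x' y)
      = (l * ∑ y', P₁ x y' + (1 - l) * p x) * ∑ x', P₁ x' y := by
    field_simp
  rwa [hnum, mul_assoc l (P₁ x y) (f _)] at h
end

section
/- Bregman mutual information is quasi information-monotone (Theorem 5.4): Let Σ_X, Σ_{X'}, Σ_Y be finite sets, let PS be a proper scoring rule on Σ_Y, let P be a joint pmf on Σ_X × Σ_Y with P_X(x) > 0 for all x, and let M be a transition matrix from Σ_X to Σ_{X'} whose pushforward joint pmf M(P) satisfies M(P)_{X'}(x') > 0 for all x'. Then (i) BMI_PS(P) ≥ 0, and (ii) BMI_PS(M(P)) ≤ BMI_PS(P). -/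
/-- A finitely supported probability mass function. -/
def IsPmf {α : Type*} [Fintype α] (p : α → ℝ) : Prop :=
  (∀ a, 0 ≤ p a) ∧ ∑ a, p a = 1

/-- A proper scoring rule on a finite set `Y`: for all pmfs `p, q` on `Y`,
`Σ_y p(y)·PS(y,q) ≤ Σ_y p(y)·PS(y,p)`. -/
def IsProperScoringRule {Y : Type*} [Fintype Y] (PS : Y → (Y → ℝ) → ℝ) : Prop :=
  ∀ p q : Y → ℝ, IsPmf p → IsPmf q →
    ∑ y, p y * PS y q ≤ ∑ y, p y * PS y p

/-- The Bregman mutual information of a joint pmf `P` on `X × Y` (with `P_X` positive):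
`BMI_PS(P) = Σ_x P_X(x)·[PS(P_{Y|X=x}, P_{Y|X=x}) − PS(P_{Y|X=x}, P_Y)]`. -/
noncomputable def BMI {X Y : Type*} [Fintype X] [Fintype Y]
    (PS : Y → (Y → ℝ) → ℝ) (P : X → Y → ℝ) : ℝ :=
  ∑ x, (∑ y, P x y) *
    ((∑ y, (P x y / ∑ y', P x y') * PS y (fun y'' => P x y'' / ∑ y', P x y'))
      - ∑ y, (P x y / ∑ y', P x y') * PS y (fun y'' => ∑ x', P x' y''))

/-- Normalizing a nonnegative function with positive total mass gives a pmf. -/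
lemma isPmf_div_sum {Y : Type*} [Fintype Y] {f : Y → ℝ} (hf : ∀ y, 0 ≤ f y)
    (hpos : 0 < ∑ y, f y) : IsPmf (fun y => f y / ∑ y', f y') :=
  ⟨fun y => div_nonneg (hf y) hpos.le, by rw [← Finset.sum_div, div_self hpos.ne']⟩

/-- Properness of a scoring rule, stated for an unnormalized true distribution. -/
lemma IsProperScoringRule.sum_mul_le {Y : Type*} [Fintype Y] {PS : Y → (Y → ℝ) → ℝ}
    (hPS : IsProperScoringRule PS) {f q : Y → ℝ} (hf : ∀ y, 0 ≤ f y)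
    (hpos : 0 < ∑ y, f y) (hq : IsPmf q) :
    ∑ y, f y * PS y q ≤ ∑ y, f y * PS y (fun y => f y / ∑ y', f y') := by
  have h := hPS _ q (isPmf_div_sum hf hpos) hq
  simp only [div_mul_eq_mul_div, ← Finset.sum_div] at h
  exact (div_le_div_iff_of_pos_right hpos).1 h

/-- The Bregman mutual information as the expected score of the conditional distributions minus
the expected score of the marginal. -/
lemma BMI_eq_sub {X Y : Type*} [Fintype X] [Fintype Y] (PS : Y → (Y → ℝ) → ℝ) {P : X → Y → ℝ}
    (hpos : ∀ x, 0 < ∑ y, P x y) :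
    BMI PS P = ∑ x, ∑ y, P x y * PS y (fun y => P x y / ∑ y', P x y')
      - ∑ x, ∑ y, P x y * PS y (fun y => ∑ x', P x' y) := by
  rw [BMI, ← Finset.sum_sub_distrib]
  refine Finset.sum_congr rfl fun x _ => ?_
  simp only [div_mul_eq_mul_div, ← Finset.sum_div]
  rw [mul_sub, mul_div_cancel₀ _ (hpos x).ne', mul_div_cancel₀ _ (hpos x).ne']

/-- Pushing forward along a transition matrix preserves the sum over the first coordinate. -/
lemma sum_sum_transition_mul {X X' : Type*} [Fintype X] [Fintype X'] {M : X → X' → ℝ}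
    (hM : ∀ x, ∑ x', M x x' = 1) (f : X → ℝ) : ∑ x', ∑ x, M x x' * f x = ∑ x, f x := by
  rw [Finset.sum_comm]
  simp [← Finset.sum_mul, hM]

/-- **Bregman mutual information is quasi information-monotone (Theorem 5.4).**
For a proper scoring rule `PS` on `Σ_Y`, a joint pmf `P` on `Σ_X × Σ_Y` with
positive `X`-marginal, and a transition matrix `M` from `Σ_X` to `Σ_{X'}` whose
pushforward has positive `X'`-marginal:
(i) `BMI_PS(P) ≥ 0`, and (ii) `BMI_PS(M(P)) ≤ BMI_PS(P)`. -/
theorem bregman_mutual_information_quasi_monotone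
    {X X' Y : Type*} [Fintype X] [Fintype X'] [Fintype Y]
    (PS : Y → (Y → ℝ) → ℝ) (hPS : IsProperScoringRule PS)
    (P : X → Y → ℝ)
    (hP_nonneg : ∀ x y, 0 ≤ P x y)
    (hP_sum : ∑ x, ∑ y, P x y = 1)
    (hPX_pos : ∀ x, 0 < ∑ y, P x y)
    (M : X → X' → ℝ)
    (hM_nonneg : ∀ x x', 0 ≤ M x x')
    (hM_rows : ∀ x, ∑ x', M x x' = 1)
    (hMPX_pos : ∀ x', 0 < ∑ y, ∑ x, M x x' * P x y) :
    0 ≤ BMI PS P ∧ BMI PS (fun x' y => ∑ x, M x x' * P x y) ≤ BMI PS P := by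
  constructor
  · rw [BMI_eq_sub PS hPX_pos, sub_nonneg]
    refine Finset.sum_le_sum fun x _ => hPS.sum_mul_le (hP_nonneg x) (hPX_pos x) ⟨fun y =>
      Finset.sum_nonneg fun x _ => hP_nonneg x y, ?_⟩
    rw [Finset.sum_comm, hP_sum]
  · rw [BMI_eq_sub PS hPX_pos, BMI_eq_sub PS hMPX_pos]
    simp only [sum_sum_transition_mul hM_rows]
    have marginal_score : ∑ x', ∑ y, (∑ x, M x x' * P x y) * PS y (fun y => ∑ x, P x y)
        = ∑ x, ∑ y, P x y * PS y (fun y => ∑ x, P x y) := by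
      rw [Finset.sum_comm, Finset.sum_comm (γ := X)]
      simp only [← Finset.sum_mul, sum_sum_transition_mul hM_rows]
    rw [marginal_score]
    refine sub_le_sub_right ?_ _
    rw [← sum_sum_transition_mul hM_rows]
    refine Finset.sum_le_sum fun x' _ => ?_
    simp only [Finset.sum_mul]
    rw [Finset.sum_comm]
    refine Finset.sum_le_sum fun x _ => ?_
    simp only [mul_assoc, ← Finset.mul_sum]
    exact mul_le_mul_of_nonneg_left (hPS.sum_mul_le (hP_nonneg x) (hPX_pos x)
      (isPmf_div_sum (fun y => Finset.sum_nonneg fun x _ =>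
        mul_nonneg (hM_nonneg x x') (hP_nonneg x y)) (hMPX_pos x'))) (hM_nonneg x x')
end

section
/- Truthful expected information score in BTS (part of Lemma 7.6): Let Σ_W, Σ_X, Σ_Y be finite sets and let P be a strictly positive joint pmf on Σ_W × Σ_X × Σ_Y such that X and Y are conditionally independent given W, i.e. P(x,y | w) = P(x | w)·P(y | w) for all w,x,y. Then Σ_{w,x,y} P(w,x,y)·[ log P(x | w) − log P(x | y) ] = I(W;X | Y). -/
/-- **Truthful expected information score in BTS (part of Lemma 7.6).**
Let `P` be a strictly positive joint pmf on `Σ_W × Σ_X × Σ_Y` such that `X` and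
`Y` are conditionally independent given `W` (`P(x,y|w) = P(x|w)·P(y|w)`). Then
`Σ_{w,x,y} P(w,x,y)·[log P(x|w) − log P(x|y)] = I(W;X|Y)`. -/
theorem bts_truthful_information_score
    {W X Y : Type*} [Fintype W] [Fintype X] [Fintype Y]
    (P : W → X → Y → ℝ)
    (hP_pos : ∀ w x y, 0 < P w x y)
    (hP_sum : ∑ w, ∑ x, ∑ y, P w x y = 1)
    (hcondindep : ∀ w x y,
      P w x y / (∑ x', ∑ y', P w x' y')
        = ((∑ y', P w x y') / (∑ x', ∑ y', P w x' y'))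
          * ((∑ x', P w x' y) / (∑ x', ∑ y', P w x' y'))) :
    (∑ w, ∑ x, ∑ y, P w x y *
        (Real.log ((∑ y', P w x y') / (∑ x', ∑ y', P w x' y'))
          - Real.log ((∑ w', P w' x y) / (∑ w', ∑ x', P w' x' y))))
      = ∑ w, ∑ x, ∑ y, P w x y *
          Real.log ((P w x y / (∑ w', ∑ x', P w' x' y)) /
            (((∑ x', P w x' y) / (∑ w', ∑ x', P w' x' y)) *
              ((∑ w', P w' x y) / (∑ w', ∑ x', P w' x' y)))) := by
  refine Finset.sum_congr rfl fun w _ => Finset.sum_congr rfl fun x _ =>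
    Finset.sum_congr rfl fun y _ => ?_
  have hW : Nonempty W := ⟨w⟩
  have hX : Nonempty X := ⟨x⟩
  have hY : Nonempty Y := ⟨y⟩
  have h := hcondindep w x y
  have hwx : 0 < ∑ y', P w x y' :=
    Finset.sum_pos (fun _ _ => hP_pos _ _ _) Finset.univ_nonempty
  have hwy : 0 < ∑ x', P w x' y :=
    Finset.sum_pos (fun _ _ => hP_pos _ _ _) Finset.univ_nonempty
  have hxy : 0 < ∑ w', P w' x y :=
    Finset.sum_pos (fun _ _ => hP_pos _ _ _) Finset.univ_nonempty
  have hw : 0 < ∑ x', ∑ y', P w x' y' :=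
    Finset.sum_pos (fun _ _ => Finset.sum_pos (fun _ _ => hP_pos _ _ _)
      Finset.univ_nonempty) Finset.univ_nonempty
  have hy : 0 < ∑ w', ∑ x', P w' x' y :=
    Finset.sum_pos (fun _ _ => Finset.sum_pos (fun _ _ => hP_pos _ _ _)
      Finset.univ_nonempty) Finset.univ_nonempty
  rw [← Real.log_div (div_pos hwx hw).ne' (div_pos hxy hy).ne']
  generalize (∑ y', P w x y') = a at *
  generalize (∑ x', P w x' y) = b at *
  generalize (∑ w', P w' x y) = d at *
  generalize (∑ x', ∑ y', P w x' y') = c at *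
  generalize (∑ w', ∑ x', P w' x' y) = e at *
  congr 2
  field_simp at h ⊢
  linarith
end

section
/- f-divergence generalization of the BTS information score computation (Theorem 7.3 core identity): Let Σ_W, Σ_X, Σ_Y be finite sets, let f : ℝ → ℝ be convex with f(1) = 0, and let P be a strictly positive joint pmf on Σ_W × Σ_X × Σ_Y such that X and Y are conditionally independent given W, i.e. P(x,y | w) = P(x | w)·P(y | w) for all w,x,y. Then Σ_{w,x,y} P(w,x,y)·f( P(x | y) / P(x | w) ) = MI_f(W;X | Y), the conditional f-mutual information of W and X given Y. -/
/-- **f-divergence generalization of the BTS information score computation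
(Theorem 7.3 core identity).** Let `f` be convex with `f 1 = 0` and `P` a
strictly positive joint pmf on `Σ_W × Σ_X × Σ_Y` such that `X` and `Y` are
conditionally independent given `W`. Then
`Σ_{w,x,y} P(w,x,y)·f(P(x|y)/P(x|w)) = MI_f(W;X|Y)`, the conditional f-mutual
information `Σ_y P(y)·MI_f(P_{(W,X)|Y=y})`. -/
theorem bts_f_information_score
    {W X Y : Type*} [Fintype W] [Fintype X] [Fintype Y]
    (f : ℝ → ℝ) (hf : ConvexOn ℝ Set.univ f) (hf1 : f 1 = 0)
    (P : W → X → Y → ℝ)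
    (hP_pos : ∀ w x y, 0 < P w x y)
    (hP_sum : ∑ w, ∑ x, ∑ y, P w x y = 1)
    (hcondindep : ∀ w x y,
      P w x y / (∑ x', ∑ y', P w x' y')
        = ((∑ y', P w x y') / (∑ x', ∑ y', P w x' y'))
          * ((∑ x', P w x' y) / (∑ x', ∑ y', P w x' y'))) :
    (∑ w, ∑ x, ∑ y, P w x y *
        f (((∑ w', P w' x y) / (∑ w', ∑ x', P w' x' y))
            / ((∑ y', P w x y') / (∑ x', ∑ y', P w x' y'))))
      = ∑ y, (∑ w', ∑ x', P w' x' y) *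
          MIf f (fun w x => P w x y / (∑ w', ∑ x', P w' x' y)) := by
  simp only [MIf, Finset.mul_sum, ← Finset.sum_div]
  have hcomm : ∀ g : W → X → Y → ℝ,
      ∑ w, ∑ x, ∑ y, g w x y = ∑ y, ∑ w, ∑ x, g w x y := fun g => by
    rw [Finset.sum_comm (s := (Finset.univ : Finset Y))]
    exact Finset.sum_congr rfl fun w _ => Finset.sum_comm
  rw [hcomm]
  refine Finset.sum_congr rfl fun y _ => Finset.sum_congr rfl fun w _ =>
    Finset.sum_congr rfl fun x _ => ?_
  have : Nonempty W := ⟨w⟩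
  have : Nonempty X := ⟨x⟩
  have : Nonempty Y := ⟨y⟩
  have hp := hP_pos w x y
  have hY : 0 < ∑ w', ∑ x', P w' x' y :=
    Finset.sum_pos (fun w' _ => Finset.sum_pos (fun x' _ => hP_pos w' x' y)
      Finset.univ_nonempty) Finset.univ_nonempty
  have hW : 0 < ∑ x', ∑ y', P w x' y' :=
    Finset.sum_pos (fun x' _ => Finset.sum_pos (fun y' _ => hP_pos w x' y')
      Finset.univ_nonempty) Finset.univ_nonempty
  have hWX : 0 < ∑ y', P w x y' :=
    Finset.sum_pos (fun y' _ => hP_pos w x y') Finset.univ_nonempty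
  have hci := hcondindep w x y
  generalize (∑ w', ∑ x', P w' x' y) = S at *
  generalize (∑ x', ∑ y', P w x' y') = D at *
  generalize (∑ y', P w x y') = B at *
  generalize (∑ x', P w x' y) = C at *
  generalize (∑ w', P w' x y) = A at *
  generalize P w x y = p at *
  have hprod : p * D = B * C := by
    field_simp at hci
    linarith
  have harg : A / S / (B / D) = C / S * (A / S) / (p / S) := by
    field_simp
    linear_combination A * hprod
  rw [harg, ← mul_assoc, mul_div_cancel₀ _ hY.ne']
end

section
/- Proposition 8.8, part (1): Fix n agents, a finite signal set Σ and a finite report set R, and let M : R^n → ℝ^n be any mechanism. For any strategy profile s = (s₁,…,sₙ) and any permutation list π = (π₁,…,πₙ): s is a strict Bayesian Nash equilibrium of M for every prior profile if and only if π(s) is a strict Bayesian Nash equilibrium of M for every prior profile. -/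
/-- A prior for `n` agents with signal set `S`: a (signed) weight function on
signal profiles; the pmf condition is imposed separately via `IsPmf`. -/
abbrev Prior (n : ℕ) (S : Type*) := (Fin n → S) → ℝ

/-- A strategy of an agent: a map from (private signal, prior) to a distribution
over reports. -/
abbrev Strategy (n : ℕ) (S R : Type*) := S → Prior n S → R → ℝ

/-- The marginal probability that agent `i`'s signal is `σ` under the prior `Qi`. -/
noncomputable def signalMarginal {n : ℕ} {S : Type*} [Fintype S] [DecidableEq S]
    (Qi : Prior n S) (i : Fin n) (σ : S) : ℝ :=
  ∑ v : Fin n → S, (if v i = σ then Qi v else 0)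

/-- Agent `i`'s interim expected payment at signal `σ` when she reports a draw
from `d`, the other agents' signals are drawn from `Q i` conditioned on agent
`i`'s signal being `σ`, and each other agent `j` reports an independent draw
from `s j (σ_j) (Q j)`. -/
noncomputable def interimPayment {n : ℕ} {S R : Type*}
    [Fintype S] [Fintype R] [DecidableEq S]
    (M : (Fin n → R) → Fin n → ℝ) (Q : Fin n → Prior n S)
    (s : Fin n → Strategy n S R) (i : Fin n) (σ : S) (d : R → ℝ) : ℝ :=
  (∑ v : Fin n → S, (if v i = σ then Q i v else 0) *
      ∑ r : Fin n → R,
        (∏ j, (if j = i then d (r j) else s j (v j) (Q j) (r j))) * M r i)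
    / signalMarginal (Q i) i σ

/-- `s` is a strict Bayesian Nash equilibrium of the mechanism `M` for the prior
profile `Q`: for every agent `i` and every signal `σ` of positive marginal
probability, the prescribed report distribution `s i σ (Q i)` yields strictly
greater interim expected payment than every other pmf on reports. -/
def StrictBNE {n : ℕ} {S R : Type*} [Fintype S] [Fintype R] [DecidableEq S]
    (M : (Fin n → R) → Fin n → ℝ) (Q : Fin n → Prior n S)
    (s : Fin n → Strategy n S R) : Prop :=
  ∀ i σ, 0 < signalMarginal (Q i) i σ →
    ∀ d : R → ℝ, IsPmf d → d ≠ s i σ (Q i) →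
      interimPayment M Q s i σ d < interimPayment M Q s i σ (s i σ (Q i))

/-- The permuted prior `π(Q')(σ₁,…,σₙ) = Q'(π₁⁻¹(σ₁),…,πₙ⁻¹(σₙ))`. -/
def permPrior {n : ℕ} {S : Type*} (π : Fin n → Equiv.Perm S)
    (Q' : Prior n S) : Prior n S :=
  fun v => Q' (fun k => (π k).symm (v k))

/-- The permuted strategy of agent `i`: `π(s_i)(σ, Q') = s_i(π_i(σ), π(Q'))`. -/
def permStrategy {n : ℕ} {S R : Type*} (π : Fin n → Equiv.Perm S) (i : Fin n)
    (si : Strategy n S R) : Strategy n S R :=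
  fun σ Q' => si (π i σ) (permPrior π Q')

/-- The permuted strategy profile `π(s) = (π(s₁),…,π(sₙ))`. -/
def permProfile {n : ℕ} {S R : Type*} (π : Fin n → Equiv.Perm S)
    (s : Fin n → Strategy n S R) : Fin n → Strategy n S R :=
  fun i => permStrategy π i (s i)

section Permutation

variable {n : ℕ} {S R : Type*}

lemma permPrior_piCongrRight (π : Fin n → Equiv.Perm S) (Q' : Prior n S) (v : Fin n → S) :
    permPrior π Q' (Equiv.piCongrRight π v) = Q' v := by
  simp [permPrior]

lemma permPrior_permPrior_symm (π : Fin n → Equiv.Perm S) (Q' : Prior n S) :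
    permPrior π (permPrior (fun k => (π k).symm) Q') = Q' := by
  funext v
  simp [permPrior]

lemma IsPmf.permPrior [Fintype S] {Q' : Prior n S} (hQ : IsPmf Q')
    (π : Fin n → Equiv.Perm S) : IsPmf (permPrior π Q') := by
  refine ⟨fun v => hQ.1 _, ?_⟩
  rw [← hQ.2, ← Equiv.sum_comp (Equiv.piCongrRight π)]
  simp only [permPrior_piCongrRight]

variable [Fintype S] [DecidableEq S]

lemma signalMarginal_permPrior (π : Fin n → Equiv.Perm S) (Q' : Prior n S)
    (i : Fin n) (σ : S) :
    signalMarginal (permPrior π Q') i (π i σ) = signalMarginal Q' i σ := by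
  unfold signalMarginal
  rw [← Equiv.sum_comp (Equiv.piCongrRight π)]
  simp only [permPrior_piCongrRight, Equiv.piCongrRight_apply, Pi.map_apply,
    EmbeddingLike.apply_eq_iff_eq]

variable [Fintype R]

lemma interimPayment_permPrior (M : (Fin n → R) → Fin n → ℝ) (Q : Fin n → Prior n S)
    (s : Fin n → Strategy n S R) (π : Fin n → Equiv.Perm S)
    (i : Fin n) (σ : S) (d : R → ℝ) :
    interimPayment M (fun j => permPrior π (Q j)) s i (π i σ) d
      = interimPayment M Q (permProfile π s) i σ d := by
  unfold interimPayment
  rw [signalMarginal_permPrior, ← Equiv.sum_comp (Equiv.piCongrRight π)]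
  simp only [permPrior_piCongrRight, Equiv.piCongrRight_apply, Pi.map_apply,
    EmbeddingLike.apply_eq_iff_eq, permProfile, permStrategy]

/-- Permuting the strategies is equivalent to permuting the priors. -/
lemma strictBNE_permProfile_iff (M : (Fin n → R) → Fin n → ℝ) (Q : Fin n → Prior n S)
    (s : Fin n → Strategy n S R) (π : Fin n → Equiv.Perm S) :
    StrictBNE M Q (permProfile π s) ↔ StrictBNE M (fun j => permPrior π (Q j)) s := by
  unfold StrictBNE
  refine forall_congr' fun i => (π i).forall_congr fun {σ} => ?_
  rw [signalMarginal_permPrior]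
  simp only [interimPayment_permPrior]
  rfl

end Permutation

/-- **Proposition 8.8, part (1).** For any mechanism `M`, strategy profile `s`
(mapping priors to report pmfs) and permutation list `π`: `s` is a strict
Bayesian Nash equilibrium of `M` for every prior profile iff `π(s)` is a strict
Bayesian Nash equilibrium of `M` for every prior profile. -/
theorem permuted_strategy_strict_BNE_iff
    {n : ℕ} {S R : Type*} [Fintype S] [Fintype R] [DecidableEq S]
    (M : (Fin n → R) → Fin n → ℝ)
    (s : Fin n → Strategy n S R)
    (hs : ∀ i σ (Q' : Prior n S), IsPmf Q' → IsPmf (s i σ Q'))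
    (π : Fin n → Equiv.Perm S) :
    (∀ Q : Fin n → Prior n S, (∀ i, IsPmf (Q i)) → StrictBNE M Q s)
      ↔ (∀ Q : Fin n → Prior n S, (∀ i, IsPmf (Q i)) →
          StrictBNE M Q (permProfile π s)) := by
  simp only [strictBNE_permProfile_iff]
  refine ⟨fun h Q hQ => h _ fun i => (hQ i).permPrior π, fun h Q hQ => ?_⟩
  have := h (fun j => permPrior (fun k => (π k).symm) (Q j)) fun i => (hQ i).permPrior _
  simpa only [permPrior_permPrior_symm] using this
end
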